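/- For every real κ̃ ≥ 1 and every λ ∈ [0, 1], f(λ)² + g(λ)² ≤ 1/4; moreover, if λ ∈ [1/κ̃, 1], then f(λ)² + g(λ)² ≥ 1/(4κ̃²). -/

import Mathlib

/-- The filter function `f`: `f(λ) = 1/(2κ̃λ)` for `λ ≥ 1/κ̃`,
`f(λ) = -(1/2)cos(πκ̃λ)` for `1/(2κ̃) ≤ λ ≤ 1/κ̃`, and `f(λ) = 0` for `λ ≤ 1/(2κ̃)`. -/
noncomputable def ff (κ lam : ℝ) : ℝ :=
  if 1 / κ ≤ lam then 1 / (2 * κ * lam)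
  else if 1 / (2 * κ) ≤ lam then -(1 / 2) * Real.cos (Real.pi * κ * lam)
  else 0

/-- The filter function `g`: `g(λ) = 0` for `λ ≥ 1/κ̃`,
`g(λ) = (1/2)sin(πκ̃λ)` for `1/(2κ̃) ≤ λ ≤ 1/κ̃`, and `g(λ) = 1/2` for `λ ≤ 1/(2κ̃)`. -/
noncomputable def gg (κ lam : ℝ) : ℝ :=
  if 1 / κ ≤ lam then 0
  else if 1 / (2 * κ) ≤ lam then (1 / 2) * Real.sin (Real.pi * κ * lam)
  else 1 / 2

theorem stmt_8 (κ : ℝ) (hκ : 1 ≤ κ) (lam : ℝ) (hlam : lam ∈ Set.Icc (0 : ℝ) 1) :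
    ff κ lam ^ 2 + gg κ lam ^ 2 ≤ 1 / 4 ∧
      (lam ∈ Set.Icc (1 / κ) 1 → 1 / (4 * κ ^ 2) ≤ ff κ lam ^ 2 + gg κ lam ^ 2) := by
  have hk : 0 < κ := by linarith
  obtain ⟨h0, h1⟩ := hlam
  by_cases ha : 1 / κ ≤ lam
  · have hl : 0 < lam := lt_of_lt_of_le (by positivity) ha
    have hkl : 1 ≤ κ * lam := by
      rw [div_le_iff₀ hk] at ha
      linarith
    have hkl2 : κ * lam ≤ κ := by nlinarith
    have e : ff κ lam ^ 2 + gg κ lam ^ 2 = 1 / (4 * (κ * lam) ^ 2) := by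
      simp only [ff, gg, if_pos ha]
      field_simp
      norm_num
    rw [e]
    refine ⟨?_, fun _ => ?_⟩
    · apply one_div_le_one_div_of_le (by norm_num)
      nlinarith
    · apply one_div_le_one_div_of_le (by positivity)
      gcongr
  · refine ⟨?_, fun h => absurd h.1 ha⟩
    simp only [ff, gg, if_neg ha]
    split_ifs
    · nlinarith [Real.sin_sq_add_cos_sq (Real.pi * κ * lam)]
    · norm_num
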